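/- Let G be a group and let L ≤ G be a subgroup of finite index n. Then there is a constant C (independent of G, L) such that the Möbius function of the subgroup lattice satisfies |μ(G, L)| ≤ e^{C (log n)²}; concretely, |μ(G, L)| ≤ n^{(log₂ n)/2}. -/

import Mathlib

open Finset in
/-- Weisner's theorem (join version). -/
lemma aux_weisner {P : Type*} [Lattice P] [OrderBot P] [Fintype P] [DecidableEq P]
    [DecidableLE P] (ν : P → ℤ)
    (hν : ∀ y : P, y ≠ ⊥ → ∑ x with x ≤ y, ν x = 0) (a : P) (ha : a ≠ ⊥) (y : P) :
    a ≤ y → ∑ x with x ⊔ a = y, ν x = 0 := by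
  induction y using WellFoundedLT.induction with
  | ind y ih =>
    intro hay
    have hy : y ≠ ⊥ := fun h => ha (le_bot_iff.mp (h ▸ hay))
    have h1 := hν y hy
    have h2 : ∑ x with x ≤ y, ν x
        = ∑ z with (a ≤ z ∧ z ≤ y), ∑ x with x ⊔ a = z, ν x := by
      rw [← Finset.sum_fiberwise_of_maps_to (s := univ.filter (fun x => x ≤ y))
        (t := univ.filter (fun z => a ≤ z ∧ z ≤ y)) (g := fun x => x ⊔ a)]
      · refine Finset.sum_congr rfl fun z hz => ?_
        refine Finset.sum_congr ?_ fun _ _ => rfl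
        ext x
        simp only [mem_filter, mem_univ, true_and] at hz ⊢
        constructor
        · exact fun h => h.2
        · intro h
          exact ⟨le_trans (h ▸ le_sup_left) hz.2, h⟩
      · intro x hx
        simp only [mem_filter, mem_univ, true_and] at hx ⊢
        exact ⟨le_sup_right, sup_le hx hay⟩
    rw [h2, Finset.sum_eq_single y] at h1
    · exact h1
    · intro z hz hzy
      simp only [mem_filter, mem_univ, true_and] at hz
      exact ih z (lt_of_le_of_ne hz.2 hzy) hz.1
    · intro h
      simp [hay] at h

open Finset in
/-- Averaged form of Weisner's theorem. -/
lemma aux_avg {P X : Type*} [Lattice P] [OrderBot P] [Fintype P] [DecidableEq P]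
    [DecidableLE P] [DecidableLT P] [Fintype X] (a : X → P) (ν : P → ℤ)
    (hν : ∀ y : P, y ≠ ⊥ → ∑ x with x ≤ y, ν x = 0)
    (hbot : #{q | a q ≤ ⊥} = 1) (y : P) :
    ((#{q | a q ≤ y} : ℝ) - 1) * |(ν y : ℝ)| ≤
      ∑ x with x < y, (#{q | x ⊔ a q = y} : ℝ) * |(ν x : ℝ)| := by
  have h1 : ∀ q, a q ≤ y → a q ≠ ⊥ →
      |(ν y : ℝ)| ≤ ∑ x with x < y, if x ⊔ a q = y then |(ν x : ℝ)| else 0 := by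
    intro q hq hq0
    have hw := aux_weisner ν hν (a q) hq0 y hq
    have hmem : y ∈ univ.filter (fun x => x ⊔ a q = y) := by simp [hq]
    rw [← Finset.add_sum_erase _ _ hmem] at hw
    have h2 : (ν y : ℝ) = - ∑ x ∈ (univ.filter (fun x => x ⊔ a q = y)).erase y, (ν x : ℝ) := by
      have : ν y = - ∑ x ∈ (univ.filter (fun x => x ⊔ a q = y)).erase y, ν x := by linarith
      exact_mod_cast this
    rw [h2, abs_neg, ← Finset.sum_filter]
    refine (Finset.abs_sum_le_sum_abs _ _).trans (le_of_eq ?_)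
    refine Finset.sum_congr ?_ fun _ _ => rfl
    ext x
    simp only [mem_erase, mem_filter, mem_univ, true_and]
    constructor
    · rintro ⟨h, h'⟩
      exact ⟨lt_of_le_of_ne (h' ▸ le_sup_left) h, h'⟩
    · rintro ⟨h, h'⟩
      exact ⟨h.ne, h'⟩
  have hc : (#{q | a q ≤ y} : ℝ) - 1 = #{q | a q ≤ y ∧ ¬ a q ≤ ⊥} := by
    have h3 := Finset.card_filter_add_card_filter_not (s := univ.filter (fun q => a q ≤ y))
      (fun q => a q ≤ ⊥)
    rw [Finset.filter_filter, Finset.filter_filter] at h3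
    have h4 : univ.filter (fun q => a q ≤ y ∧ a q ≤ ⊥) = univ.filter (fun q => a q ≤ ⊥) := by
      ext q
      simp only [mem_filter, mem_univ, true_and]
      exact ⟨fun h => h.2, fun h => ⟨h.trans bot_le, h⟩⟩
    rw [h4, hbot] at h3
    rw [← h3]; push_cast; ring
  rw [hc]
  calc (#{q | a q ≤ y ∧ ¬ a q ≤ ⊥} : ℝ) * |(ν y : ℝ)|
      = ∑ q with (a q ≤ y ∧ ¬ a q ≤ ⊥), |(ν y : ℝ)| := by simp
    _ ≤ ∑ q with (a q ≤ y ∧ ¬ a q ≤ ⊥),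
          ∑ x with x < y, if x ⊔ a q = y then |(ν x : ℝ)| else 0 := by
        refine Finset.sum_le_sum fun q hq => ?_
        simp only [mem_filter, mem_univ, true_and] at hq
        exact h1 q hq.1 fun h => hq.2 h.le
    _ ≤ ∑ q, ∑ x with x < y, if x ⊔ a q = y then |(ν x : ℝ)| else 0 := by
        refine Finset.sum_le_sum_of_subset_of_nonneg (Finset.subset_univ _) fun q _ _ => ?_
        refine Finset.sum_nonneg fun x _ => ?_
        split_ifs <;> positivity
    _ = _ := by
        rw [Finset.sum_comm]
        refine Finset.sum_congr rfl fun x _ => ?_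
        rw [← Finset.sum_filter]
        simp

open Finset in
/-- Comparison of a subharmonic and a superharmonic function. -/
lemma aux_compare {P : Type*} [PartialOrder P] [BoundedOrder P] [Fintype P] [DecidableEq P]
    [DecidableLE P] [DecidableLT P] (hne : (⊥ : P) ≠ ⊤) (k h U : P → ℝ) (c : P → P → ℝ)
    (hk : ∀ y, y ≠ ⊥ → 1 < k y)
    (hh : ∀ x, 0 ≤ h x) (hbot : h ⊥ = 1) (hU : ∀ x, 0 ≤ U x) (hUtop : U ⊤ = 1)
    (hsub : ∀ y, y ≠ ⊥ → (k y - 1) * h y ≤ ∑ x with x < y, c x y * h x)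
    (hsup : ∀ x, x ≠ ⊤ → ∑ y with x < y, c x y * (U y / (k y - 1)) ≤ U x) :
    h ⊤ ≤ U ⊥ := by
  have h1 : ∑ y ∈ univ.erase (⊥ : P), h y * U y ≤ ∑ x ∈ univ.erase (⊤ : P), h x * U x := by
    calc ∑ y ∈ univ.erase (⊥ : P), h y * U y
        ≤ ∑ y ∈ univ.erase (⊥ : P), ∑ x with x < y, c x y * h x * (U y / (k y - 1)) := by
          refine Finset.sum_le_sum fun y hy => ?_
          have hy' : y ≠ ⊥ := Finset.ne_of_mem_erase hy
          have hk' : 0 < k y - 1 := by linarith [hk y hy']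
          rw [← Finset.sum_mul]
          calc h y * U y = ((k y - 1) * h y) * (U y / (k y - 1)) := by field_simp
            _ ≤ _ := mul_le_mul_of_nonneg_right (hsub y hy') (div_nonneg (hU y) hk'.le)
      _ = ∑ x ∈ univ.erase (⊤ : P), ∑ y with x < y, c x y * h x * (U y / (k y - 1)) := by
          refine Finset.sum_comm' fun y x => ?_
          simp only [mem_erase, mem_filter, mem_univ, true_and, and_true]
          constructor
          · rintro ⟨_, hlt⟩
            exact ⟨hlt, (lt_of_lt_of_le hlt le_top).ne⟩
          · rintro ⟨hlt, _⟩
            exact ⟨(lt_of_le_of_lt bot_le hlt).ne', hlt⟩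
      _ ≤ _ := by
          refine Finset.sum_le_sum fun x hx => ?_
          have hx' : x ≠ ⊤ := Finset.ne_of_mem_erase hx
          calc _ = h x * ∑ y with x < y, c x y * (U y / (k y - 1)) := by
                rw [Finset.mul_sum]
                exact Finset.sum_congr rfl fun y _ => by ring
            _ ≤ _ := mul_le_mul_of_nonneg_left (hsup x hx') (hh x)
  have e1 := Finset.add_sum_erase univ (fun x => h x * U x) (Finset.mem_univ (⊥ : P))
  have e2 := Finset.add_sum_erase univ (fun x => h x * U x) (Finset.mem_univ (⊤ : P))
  simp only [hbot, hUtop] at e1 e2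
  linarith

/-- The numerical inequality away from the bottom. -/
lemma aux_num1 (n k k' : ℝ) (hk : 2 ≤ k) (hkk : 2 * k ≤ k') (hk' : k' ≤ n) :
    (n - k) * ((2 : ℝ) ^ ((Real.logb 2 (n / k') ^ 2 - 1) / 2) / (k' - 1)) ≤
      (2 : ℝ) ^ ((Real.logb 2 (n / k) ^ 2 - 1) / 2) := by
  have hn : 0 < n := by linarith
  set d := Real.logb 2 (n / k) with hd
  have hk0 : 0 < k := by linarith
  have h0 : 0 ≤ Real.logb 2 (n / k') :=
    Real.logb_nonneg (by norm_num) ((one_le_div (by linarith)).mpr hk')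
  have h1 : Real.logb 2 (n / k') ≤ d - 1 := by
    have : d - 1 = Real.logb 2 (n / k / 2) := by
      rw [Real.logb_div (by positivity) (by norm_num), Real.logb_self_eq_one (by norm_num)]
    rw [this]
    refine Real.logb_le_logb_of_le (by norm_num) (div_pos hn (by linarith)) ?_
    rw [div_div]
    exact div_le_div_of_nonneg_left hn.le (by linarith) (by linarith)
  have h2 : (2 : ℝ) ^ ((Real.logb 2 (n / k') ^ 2 - 1) / 2) ≤ 2 ^ (((d - 1) ^ 2 - 1) / 2) := by
    refine Real.rpow_le_rpow_of_exponent_le (by norm_num) ?_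
    nlinarith
  have h3 : (2 : ℝ) ^ (((d - 1) ^ 2 - 1) / 2) = 2 ^ ((d ^ 2 - 1) / 2) * (√2 * (k / n)) := by
    have e1 : (2 : ℝ) ^ (-d) = k / n := by
      rw [Real.rpow_neg (by norm_num), hd, Real.rpow_logb (by norm_num) (by norm_num)
        (by positivity), inv_div]
    rw [← e1, Real.sqrt_eq_rpow, ← Real.rpow_add (by norm_num), ← Real.rpow_add (by norm_num)]
    congr 1; ring
  have hs : √2 ≤ 3 / 2 := by
    rw [Real.sqrt_le_left (by norm_num)]; norm_num
  have hp : (0 : ℝ) < 2 ^ ((d ^ 2 - 1) / 2) := by positivity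
  have hk1 : 0 < k' - 1 := by linarith
  rw [← mul_div_assoc, div_le_iff₀ hk1]
  calc _ ≤ (n - k) * (2 ^ ((d ^ 2 - 1) / 2) * (√2 * (k / n))) := by
        rw [← h3]
        exact mul_le_mul_of_nonneg_left h2 (by linarith)
    _ = 2 ^ ((d ^ 2 - 1) / 2) * (((n - k) / n) * (√2 * k)) := by field_simp
    _ ≤ _ := by
        refine mul_le_mul_of_nonneg_left ?_ hp.le
        have : (n - k) / n ≤ 1 := by rw [div_le_one hn]; linarith
        have h5 : 0 ≤ √2 * k := by positivity
        nlinarith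

/-- The numerical inequality at the bottom. -/
lemma aux_num2 (n k' : ℝ) (hkk : 2 ≤ k') (hk' : k' ≤ n) :
    (n - 1) * ((2 : ℝ) ^ ((Real.logb 2 (n / k') ^ 2 - 1) / 2) / (k' - 1)) ≤
      (2 : ℝ) ^ (Real.logb 2 n ^ 2 / 2) := by
  have hn : 0 < n := by linarith
  set d := Real.logb 2 n with hd
  have h0 : 0 ≤ Real.logb 2 (n / k') :=
    Real.logb_nonneg (by norm_num) ((one_le_div (by linarith)).mpr hk')
  have h1 : Real.logb 2 (n / k') ≤ d - 1 := by
    have : d - 1 = Real.logb 2 (n / 2) := by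
      rw [Real.logb_div (by positivity) (by norm_num), Real.logb_self_eq_one (by norm_num)]
    rw [this]
    refine Real.logb_le_logb_of_le (by norm_num) (div_pos hn (by linarith)) ?_
    exact div_le_div_of_nonneg_left hn.le (by linarith) (by linarith)
  have h2 : (2 : ℝ) ^ ((Real.logb 2 (n / k') ^ 2 - 1) / 2) ≤ 2 ^ (((d - 1) ^ 2 - 1) / 2) := by
    refine Real.rpow_le_rpow_of_exponent_le (by norm_num) ?_
    nlinarith
  have h3 : (2 : ℝ) ^ (((d - 1) ^ 2 - 1) / 2) = 2 ^ (d ^ 2 / 2) * (1 / n) := by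
    have e1 : (2 : ℝ) ^ (-d) = 1 / n := by
      rw [Real.rpow_neg (by norm_num), hd, Real.rpow_logb (by norm_num) (by norm_num)
        (by positivity), one_div]
    rw [← e1, ← Real.rpow_add (by norm_num)]
    congr 1; ring
  have hp : (0 : ℝ) < 2 ^ (d ^ 2 / 2) := by positivity
  have hk1 : 0 < k' - 1 := by linarith
  rw [← mul_div_assoc, div_le_iff₀ hk1]
  calc _ ≤ (n - 1) * (2 ^ (d ^ 2 / 2) * (1 / n)) := by
        rw [← h3]
        exact mul_le_mul_of_nonneg_left h2 (by linarith)
    _ = 2 ^ (d ^ 2 / 2) * ((n - 1) / n) := by field_simp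
    _ ≤ _ := by
        refine mul_le_mul_of_nonneg_left ?_ hp.le
        have : (n - 1) / n ≤ 1 := by rw [div_le_one hn]; linarith
        linarith

open Finset in
/-- The abstract lattice version. -/
lemma aux_abstract {P X : Type*} [Lattice P] [BoundedOrder P] [Fintype P] [DecidableEq P]
    [DecidableLE P] [DecidableLT P] [Fintype X] (hne : (⊥ : P) ≠ ⊤) (a : X → P)
    (hbot : #{q | a q ≤ ⊥} = 1)
    (hdbl : ∀ x y : P, x < y → 2 * #{q | a q ≤ x} ≤ #{q | a q ≤ y})
    (μ : P → ℤ) (hμtop : μ ⊤ = 1) (hμ : ∀ x, x ≠ ⊤ → ∑ y with x ≤ y, μ y = 0) :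
    |(μ ⊥ : ℝ)| ≤ (2 : ℝ) ^ (Real.logb 2 (Fintype.card X) ^ 2 / 2) := by
  classical
  letI : LocallyFiniteOrder P := Fintype.toLocallyFiniteOrder
  obtain ⟨ν, hν⟩ : ∃ ν : P → ℤ, ∀ y, ∑ x with x ≤ y, ν x = if y = ⊥ then 1 else 0 := by
    refine ⟨fun x => IncidenceAlgebra.mu ℤ (⊥ : P) x, fun y => ?_⟩
    have := IncidenceAlgebra.sum_Icc_mu_right (𝕜 := ℤ) (⊥ : P) y
    rw [← show Finset.Icc ⊥ y = univ.filter (fun x => x ≤ y) by ext; simp, this]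
    simp [eq_comm]
  have hν0 : ∀ y : P, y ≠ ⊥ → ∑ x with x ≤ y, ν x = 0 := fun y hy => by rw [hν, if_neg hy]
  have hνbot : ν ⊥ = 1 := by
    have := hν ⊥
    simpa [Finset.sum_filter] using this
  have hμ' : ∀ x, ∑ y with x ≤ y, μ y = if x = ⊤ then 1 else 0 := by
    intro x
    split_ifs with h
    · subst h
      simp [Finset.sum_filter, hμtop]
    · exact hμ x h
  have hμν : μ ⊥ = ν ⊤ := by
    have e1 : ∑ y, μ y * ∑ x with x ≤ y, ν x = μ ⊥ := by simp [hν]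
    have e2 : ∑ x, ν x * ∑ y with x ≤ y, μ y = ν ⊤ := by simp [hμ']
    rw [← e1, ← e2]
    simp only [Finset.sum_filter, Finset.mul_sum]
    rw [Finset.sum_comm]
    refine Finset.sum_congr rfl fun x _ => Finset.sum_congr rfl fun y _ => ?_
    split_ifs <;> ring
  rw [hμν]
  set n : ℝ := (Fintype.card X : ℝ) with hn
  set k : P → ℝ := fun x => (#{q | a q ≤ x} : ℝ) with hk
  have hkbot : k ⊥ = 1 := by simp only [hk, hbot, Nat.cast_one]
  have hktop : k ⊤ = n := by simp [hk, hn]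
  have hkd : ∀ x y : P, x < y → 2 * k x ≤ k y := fun x y h => by
    simp only [hk]; exact_mod_cast hdbl x y h
  have hk2 : ∀ y, y ≠ ⊥ → 2 ≤ k y := fun y hy => by
    have := hkd ⊥ y (bot_lt_iff_ne_bot.mpr hy); linarith
  have hn2 : 2 ≤ n := hktop ▸ hk2 ⊤ hne.symm
  have hkn : ∀ y, k y ≤ n := fun y => by
    simp only [hk, hn]; exact_mod_cast Finset.card_le_univ _
  set U : P → ℝ := fun x => if x = ⊤ then 1 else if x = ⊥ then
    (2 : ℝ) ^ (Real.logb 2 n ^ 2 / 2) else (2 : ℝ) ^ ((Real.logb 2 (n / k x) ^ 2 - 1) / 2) with hUdef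
  have hU0 : ∀ x, 0 ≤ U x := fun x => by
    simp only [hUdef]; split_ifs <;> positivity
  have key := aux_compare hne k (fun x => |(ν x : ℝ)|) U
    (fun x y => (#{q | x ⊔ a q = y} : ℝ)) (fun y hy => by linarith [hk2 y hy])
    (fun x => abs_nonneg _) (by simp [hνbot]) hU0 (by simp [hUdef])
    (fun y _ => aux_avg a ν hν0 hbot y) ?_
  · simpa [hUdef, hne] using key
  intro x hx
  have hxt : 2 * k x ≤ n := hktop ▸ hkd x ⊤ (lt_top_iff_ne_top.mpr hx)
  have hkx : 1 ≤ k x := by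
    by_cases h : x = ⊥
    · rw [h, hkbot]
    · linarith [hk2 x h]
  have hnk : 0 < n - k x := by linarith
  have hpt : ∀ y, x < y → U y / (k y - 1) ≤ U x / (n - k x) := by
    intro y hxy
    have hy0 : y ≠ ⊥ := (lt_of_le_of_lt bot_le hxy).ne'
    rw [le_div_iff₀ hnk, mul_comm]
    by_cases hyt : y = ⊤
    · have hUy : U y = 1 := by simp [hUdef, hyt]
      rw [hUy, hyt, hktop]
      have h1 : (n - k x) * (1 / (n - 1)) ≤ 1 := by
        rw [mul_one_div, div_le_one (by linarith)]; linarith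
      refine h1.trans ?_
      by_cases hxb : x = ⊥
      · simp only [hUdef, hx, hxb, hne, if_true, if_false]
        exact Real.one_le_rpow (by norm_num) (by positivity)
      · simp only [hUdef, hx, hxb, if_false]
        refine Real.one_le_rpow (by norm_num) ?_
        have : 1 ≤ Real.logb 2 (n / k x) := by
          rw [Real.le_logb_iff_rpow_le (by norm_num) (div_pos (by linarith) (by linarith)),
            Real.rpow_one, le_div_iff₀ (by linarith)]
          exact hxt
        nlinarith
    · have hUy : U y = (2 : ℝ) ^ ((Real.logb 2 (n / k y) ^ 2 - 1) / 2) := by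
        simp only [hUdef, hyt, hy0, if_false]
      rw [hUy]
      by_cases hxb : x = ⊥
      · have hUx : U x = (2 : ℝ) ^ (Real.logb 2 n ^ 2 / 2) := by
          simp only [hUdef, hxb, hne, if_true, if_false]
        rw [hUx, hxb, hkbot]
        exact aux_num2 n (k y) (hk2 y hy0) (hkn y)
      · have hUx : U x = (2 : ℝ) ^ ((Real.logb 2 (n / k x) ^ 2 - 1) / 2) := by
          simp only [hUdef, hx, hxb, if_false]
        rw [hUx]
        exact aux_num1 n (k x) (k y) (hk2 x hxb) (hkd x y hxy) (hkn y)
  have hcard : ∑ y with x < y, (#{q | x ⊔ a q = y} : ℝ) = n - k x := by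
    have h1 : ∑ y with x < y, #{q | x ⊔ a q = y} = #{q | ¬ a q ≤ x} := by
      rw [Finset.card_eq_sum_card_fiberwise (s := univ.filter (fun q => ¬ a q ≤ x))
        (t := univ.filter (fun y => x < y)) (f := fun q => x ⊔ a q)]
      · refine Finset.sum_congr rfl fun y hy => ?_
        congr 1
        ext q
        simp only [mem_filter, mem_univ, true_and] at hy ⊢
        constructor
        · intro h
          refine ⟨fun h' => ?_, h⟩
          rw [sup_eq_left.mpr h'] at h
          exact hy.ne h
        · exact fun h => h.2
      · intro q hq
        simpa using hq
    have h2 := Finset.card_filter_add_card_filter_not (s := (univ : Finset X))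
      (fun q => a q ≤ x)
    rw [Finset.card_univ] at h2
    have h3 : (∑ y with x < y, (#{q | x ⊔ a q = y} : ℝ)) = (#{q | ¬ a q ≤ x} : ℝ) := by
      exact_mod_cast h1
    rw [h3, hn, ← h2]
    simp [hk]
  calc _ ≤ ∑ y with x < y, (#{q | x ⊔ a q = y} : ℝ) * (U x / (n - k x)) := by
        refine Finset.sum_le_sum fun y hy => ?_
        simp only [mem_filter, mem_univ, true_and] at hy
        exact mul_le_mul_of_nonneg_left (hpt y hy) (Nat.cast_nonneg _)
    _ = U x := by
        rw [← Finset.sum_mul, hcard]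
        field_simp

/-- Let `L ≤ G` have finite index `n`, and let `μ` be the Möbius function of the
interval `[L, G]` in the subgroup lattice, characterized by `μ(G,G) = 1` and
`∑_{K' : K ≤ K' ≤ G} μ(G,K') = 0` for `L ≤ K < G` (here `μ K` denotes `μ(G,K)`).
Then `|μ(G,L)| ≤ n^{(log₂ n)/2} = e^{(log n)²/(2 log 2)}`. -/
theorem mobius_bound (G : Type*) [Group G] (L : Subgroup G) (n : ℕ)
    (hn : L.index = n) (hfin : n ≠ 0) (μ : Subgroup G → ℤ)
    (hμtop : μ ⊤ = 1)
    (hμ : ∀ K : Subgroup G, L ≤ K → K < ⊤ →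
      ∑ᶠ K' ∈ {K' : Subgroup G | K ≤ K'}, μ K' = 0) :
    |(μ L : ℝ)| ≤ (n : ℝ) ^ (Real.logb 2 n / 2) := by
  classical
  have hnpos : (0 : ℝ) < n := by exact_mod_cast Nat.pos_of_ne_zero hfin
  have hrw : (n : ℝ) ^ (Real.logb 2 n / 2) = (2 : ℝ) ^ (Real.logb 2 n ^ 2 / 2) := by
    have e : (n : ℝ) = (2 : ℝ) ^ Real.logb 2 n :=
      (Real.rpow_logb (by norm_num) (by norm_num) hnpos).symm
    generalize Real.logb 2 n = l at e ⊢
    rw [e, ← Real.rpow_mul (by norm_num)]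
    congr 1; ring
  rw [hrw]
  by_cases hL : L = ⊤
  · rw [hL, hμtop]
    simpa using Real.one_le_rpow (by norm_num : (1 : ℝ) ≤ 2) (by positivity)
  have hfi : L.FiniteIndex := ⟨hn ▸ hfin⟩
  haveI : Finite (G ⧸ L) := Subgroup.finite_quotient_of_finiteIndex
  letI : Fintype (G ⧸ L) := Fintype.ofFinite _
  have hout : ∀ (K : Subgroup G), L ≤ K → ∀ g : G, (g : G ⧸ L).out ∈ K ↔ g ∈ K := by
    intro K hK g
    obtain ⟨h, hh⟩ := QuotientGroup.mk_out_eq_mul L g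
    rw [hh]
    exact K.mul_mem_cancel_right (hK h.2)
  let S : Subgroup G → Set (G ⧸ L) := fun K => {q | q.out ∈ K}
  have hinj : Function.Injective (fun K : Set.Ici L => S K.1) := by
    intro K K' h
    ext g
    have h' : (g : G ⧸ L) ∈ S K.1 ↔ (g : G ⧸ L) ∈ S K'.1 := by
      have : S K.1 = S K'.1 := h
      rw [this]
    simpa [S, hout K.1 K.2, hout K'.1 K'.2] using h'
  haveI : Finite (Set.Ici L) := Finite.of_injective _ hinj
  letI : Fintype (Set.Ici L) := Fintype.ofFinite _
  letI : BoundedOrder (Set.Ici L) := { }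
  let a : G ⧸ L → Set.Ici L := fun q => ⟨L ⊔ Subgroup.zpowers q.out, Set.mem_Ici.mpr le_sup_left⟩
  have ha : ∀ (q : G ⧸ L) (K : Set.Ici L), a q ≤ K ↔ q.out ∈ K.1 := by
    intro q K
    change L ⊔ Subgroup.zpowers q.out ≤ K.1 ↔ _
    rw [sup_le_iff, Subgroup.zpowers_le]
    exact ⟨fun h => h.2, fun h => ⟨K.2, h⟩⟩
  have hcardX : Fintype.card (G ⧸ L) = n := by
    rw [← hn, Subgroup.index, Nat.card_eq_fintype_card]
  have main := aux_abstract (P := Set.Ici L) (X := G ⧸ L) ?_ a ?_ ?_ (fun K => μ K.1) hμtop ?_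
  · rw [hcardX] at main
    exact main
  · intro h
    exact hL (congrArg Subtype.val h)
  · rw [Finset.card_eq_one]
    refine ⟨((1 : G) : G ⧸ L), ?_⟩
    ext q
    simp only [Finset.mem_filter, Finset.mem_univ, true_and, Finset.mem_singleton, ha]
    change q.out ∈ L ↔ _
    constructor
    · intro h
      rw [← QuotientGroup.out_eq' q, QuotientGroup.eq]
      simpa using h
    · rintro rfl
      exact (hout L le_rfl 1).mpr L.one_mem
  · intro x y hxy
    obtain ⟨g, hgy, hgx⟩ : ∃ g, g ∈ y.1 ∧ g ∉ x.1 := by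
      have : x.1 < y.1 := hxy
      exact SetLike.exists_of_lt this
    have hact : ∀ (K : Set.Ici L) (q : G ⧸ L), (g • q).out ∈ K.1 ↔ g * q.out ∈ K.1 := by
      intro K q
      have : g • q = ((g * q.out : G) : G ⧸ L) := by
        conv_lhs => rw [← QuotientGroup.out_eq' q]
        rfl
      rw [this, hout K.1 K.2]
    have hxy' : x.1 ≤ y.1 := hxy.le
    set A := Finset.univ.filter (fun q => a q ≤ x) with hA
    have hdisj : Disjoint A (A.image (fun q => g • q)) := by
      rw [Finset.disjoint_left]
      intro q hq hq'
      obtain ⟨r, hr, rfl⟩ := Finset.mem_image.mp hq'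
      simp only [hA, Finset.mem_filter, Finset.mem_univ, true_and, ha] at hq hr
      rw [hact, x.1.mul_mem_cancel_right hr] at hq
      exact hgx hq
    have hci : (A.image (fun q => g • q)).card = A.card :=
      Finset.card_image_of_injective _ (MulAction.injective g)
    rw [two_mul]
    nth_rewrite 2 [← hci]
    rw [← Finset.card_union_of_disjoint hdisj]
    refine Finset.card_le_card ?_
    intro q hq
    rcases Finset.mem_union.mp hq with hq | hq
    · simp only [hA, Finset.mem_filter, Finset.mem_univ, true_and, ha] at hq ⊢
      exact hxy' hq
    · obtain ⟨r, hr, rfl⟩ := Finset.mem_image.mp hq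
      simp only [hA, Finset.mem_filter, Finset.mem_univ, true_and, ha] at hr ⊢
      rw [hact]
      exact y.1.mul_mem hgy (hxy' hr)
  · intro x hx
    have hx' : x.1 < ⊤ := lt_top_iff_ne_top.mpr fun h => hx (Subtype.ext h)
    have h := hμ x.1 x.2 hx'
    rw [← h]
    symm
    have hset : {K' : Subgroup G | x.1 ≤ K'} =
        ↑((Finset.univ.filter (fun y : Set.Ici L => x ≤ y)).map
          (Function.Embedding.subtype _)) := by
      ext K
      simp only [Set.mem_setOf_eq, Finset.coe_map, Set.mem_image, Finset.mem_coe,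
        Finset.mem_filter, Finset.mem_univ, true_and, Function.Embedding.subtype_apply]
      constructor
      · intro hK
        exact ⟨⟨K, Set.mem_Ici.mpr (le_trans x.2 hK)⟩, hK, rfl⟩
      · rintro ⟨y, hy, rfl⟩
        exact hy
    rw [hset, finsum_mem_coe_finset, Finset.sum_map]
    rfl
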